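/- arXiv:1604.00114 — 3 statements merged into one kernel-verified Lean document; each statement's English description precedes it below -/
import Mathlib

section
/- Let n ≥ 2 and a ∈ {1,…,n}. Then Hom_B(O^a, O^a) is isomorphic to A/(z_a) as a k-vector space, and for every integer j ≥ 1, Ext^{2j}_B(O^a, O^a) is isomorphic to the quotient A/(z_a, W^a) as a k-vector space. (This is the even-degree part of the paper's computation H^*(Hom(O^a, O^a)) ≅ A[u]/(z_a, u·W^a), with u a variable of cohomological degree 2, in its proposition on morphisms between the hyperplane sheaves on X_{n-1}.) -/
open CategoryTheory MvPolynomial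

noncomputable section

set_option maxHeartbeats 1000000
set_option synthInstance.maxHeartbeats 1000000

/-- `B = k[z_1,…,z_n]/(z_1⋯z_n)`, the coordinate ring of the union of
coordinate hyperplanes `X_{n-1} ⊂ 𝔸^n`. -/
abbrev Bquot (k : Type) [Field k] (n : ℕ) : Type :=
  MvPolynomial (Fin n) k ⧸
    Ideal.span ({∏ b : Fin n, X b} : Set (MvPolynomial (Fin n) k))

/-- `O^a = B/(z_a)`, the structure sheaf of the coordinate hyperplane
`{z_a = 0}` as an object of `Coh(X_{n-1}) = Mod(B)`. -/
abbrev hyperplaneSheaf (k : Type) [Field k] (n : ℕ) (a : Fin n) :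
    ModuleCat (Bquot k n) :=
  ModuleCat.of (Bquot k n)
    (Bquot k n ⧸
      Ideal.span
        ({Ideal.Quotient.mk
            (Ideal.span ({∏ b : Fin n, X b} : Set (MvPolynomial (Fin n) k)))
            (X a)} : Set (Bquot k n)))

namespace ExtAux

variable {k : Type} [Field k] {R : Type} [CommRing R] [Algebra k R]

def mulHom (x : R) : ModuleCat.of R R ⟶ ModuleCat.of R R :=
  ModuleCat.ofHom (LinearMap.lsmul R R x)

theorem mulHom_apply (x r : R) : (mulHom x).hom r = x * r := rfl

theorem mulHom_comp {x w : R} (h : x * w = 0) : mulHom x ≫ mulHom w = 0 := by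
  apply ModuleCat.hom_ext
  apply LinearMap.ext
  intro r
  change w * (x * r) = 0
  rw [← mul_assoc, mul_comm w x, h, zero_mul]

theorem exact_mulHom {x w : R} (h : x * w = 0) (h' : ∀ r, w * r = 0 → x ∣ r) :
    (ShortComplex.mk (mulHom x) (mulHom w) (mulHom_comp h)).Exact := by
  rw [ShortComplex.moduleCat_exact_iff]
  intro r hr
  obtain ⟨c, hc⟩ := h' r hr
  exact ⟨c, hc.symm⟩

/-- periodic complex: even degrees `i` have `d_i = w`, odd ones `d_i = x`. -/
def cx {x w : R} (h : x * w = 0) : ChainComplex (ModuleCat.{0} R) ℕ :=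
  HomologicalComplex.alternatingConst (ModuleCat.of R R) (φ := mulHom w) (ψ := mulHom x)
    (mulHom_comp (by rw [mul_comm]; exact h)) (mulHom_comp h)
    fun _ _ => ComplexShape.down_nat_odd_add

theorem cx_d_even {x w : R} (h : x * w = 0) (i j : ℕ) (hij : j + 1 = i) (hi : Even i) :
    (cx h).d i j = mulHom w := by
  simp only [cx, HomologicalComplex.alternatingConst]
  rw [dif_pos (show (ComplexShape.down ℕ).Rel i j from hij), dif_pos hi]

theorem cx_d_odd {x w : R} (h : x * w = 0) (i j : ℕ) (hij : j + 1 = i) (hi : ¬ Even i) :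
    (cx h).d i j = mulHom x := by
  simp only [cx, HomologicalComplex.alternatingConst]
  rw [dif_pos (show (ComplexShape.down ℕ).Rel i j from hij), dif_neg hi]

abbrev Mx (x : R) : ModuleCat.{0} R := ModuleCat.of R (R ⧸ Ideal.span ({x} : Set R))

def aug (x : R) : ModuleCat.of R R ⟶ Mx x :=
  ModuleCat.ofHom (Submodule.mkQ (Ideal.span ({x} : Set R)))

theorem mulHom_aug (x : R) : mulHom x ≫ aug x = 0 := by
  apply ModuleCat.hom_ext
  apply LinearMap.ext
  intro r
  change (Ideal.Quotient.mk (Ideal.span ({x} : Set R))) (x * r) = 0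
  rw [Ideal.Quotient.eq_zero_iff_mem, Ideal.mem_span_singleton]
  exact ⟨r, rfl⟩

theorem exact_aug (x : R) : (ShortComplex.mk (mulHom x) (aug x) (mulHom_aug x)).Exact := by
  rw [ShortComplex.moduleCat_exact_iff]
  intro r hr
  change (Ideal.Quotient.mk (Ideal.span ({x} : Set R))) r = 0 at hr
  rw [Ideal.Quotient.eq_zero_iff_mem, Ideal.mem_span_singleton] at hr
  obtain ⟨c, hc⟩ := hr
  exact ⟨c, hc.symm⟩

theorem cx_d_aug {x w : R} (h : x * w = 0) : (cx h).d 1 0 ≫ aug x = 0 := by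
  rw [cx_d_odd h 1 0 rfl (by decide)]; exact mulHom_aug x

def cxπ {x w : R} (h : x * w = 0) : cx h ⟶ (ChainComplex.single₀ _).obj (Mx x) :=
  ((cx h).toSingle₀Equiv _).symm ⟨aug x, cx_d_aug h⟩

theorem quasi {x w : R} (h : x * w = 0) (h1 : ∀ r, w * r = 0 → x ∣ r)
    (h2 : ∀ r, x * r = 0 → w ∣ r) : QuasiIso (cxπ h) where
  quasiIsoAt m := by
    induction m with
    | zero =>
      rw [ChainComplex.quasiIsoAt₀_iff, ShortComplex.quasiIso_iff_of_zeros' _ rfl rfl rfl]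
      constructor
      · refine (ShortComplex.exact_iff_of_iso ?_).1 (exact_aug x)
        refine ShortComplex.isoMk (Iso.refl _) (Iso.refl _) (Iso.refl _) ?_ ?_
        · change 𝟙 _ ≫ (cx h).d 1 0 = mulHom x ≫ 𝟙 _
          rw [cx_d_odd h 1 0 rfl (by decide)]
          exact (Category.id_comp _).trans (Category.comp_id _).symm
        · change 𝟙 _ ≫ (cxπ h).f 0 = aug x ≫ 𝟙 _
          have : (cxπ h).f 0 = aug x := by
            exact ChainComplex.toSingle₀Equiv_symm_apply_f_zero _ _
          rw [this]
          exact (Category.id_comp _).trans (Category.comp_id _).symm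
      · change Epi ((cxπ h).f 0)
        have : (cxπ h).f 0 = aug x := ChainComplex.toSingle₀Equiv_symm_apply_f_zero _ _
        rw [this]
        refine (ModuleCat.epi_iff_surjective (aug x)).2 ?_
        exact Submodule.mkQ_surjective _
    | succ m _ =>
      rw [quasiIsoAt_iff_exactAt' (hL := ChainComplex.exactAt_succ_single_obj ..),
          HomologicalComplex.exactAt_iff' _ (m + 2) (m + 1) m (by simp) (by simp)]
      by_cases hm : Even (m + 1)
      · exact (ShortComplex.exact_iff_of_iso
          (HomologicalComplex.alternatingConstScIsoEven _ _ _ _ rfl rfl hm)).2 (exact_mulHom h h1)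
      · exact (ShortComplex.exact_iff_of_iso
          (HomologicalComplex.alternatingConstScIsoOdd _ _ _ _ rfl rfl
           (Nat.not_even_iff_odd.1 hm))).2 (exact_mulHom (by rw [mul_comm]; exact h) h2)

def res {x w : R} (h : x * w = 0) (h1 : ∀ r, w * r = 0 → x ∣ r)
    (h2 : ∀ r, x * r = 0 → w ∣ r) : ProjectiveResolution (Mx x) where
  complex := cx h
  projective _ := inferInstanceAs <| Projective (ModuleCat.of R R)
  π := cxπ h
  quasiIso := quasi h h1 h2

theorem homology_equiv (S : ShortComplex (ModuleCat.{0} k)) (hg : S.g = 0) {T : Type}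
    [AddCommGroup T] [Module k T] (L : S.X₂ →ₗ[k] T) (hL : Function.Surjective L)
    (hk : LinearMap.ker L = LinearMap.range S.f.hom) : Nonempty (S.homology ≃ₗ[k] T) := by
  have e1 : S.homology ≅ S.opcycles := by
    have := S.isIso_homologyι hg
    exact asIso S.homologyι
  have e3 : (S.X₂ ⧸ LinearMap.range S.f.hom) ≃ₗ[k] T :=
    (Submodule.quotEquivOfEq _ _ hk.symm).trans (L.quotKerEquivOfSurjective hL)
  exact ⟨e1.toLinearEquiv.trans (S.moduleCatOpcyclesIso.toLinearEquiv.trans e3)⟩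


def ev (x : R) (f : ModuleCat.of R R ⟶ Mx x) : R ⧸ Ideal.span ({x} : Set R) := f.hom (1 : R)

variable (k) in
def evL (x : R) : ((linearYoneda k (ModuleCat.{0} R)).obj (Mx x)).obj
    (Opposite.op (ModuleCat.of R R)) →ₗ[k] R ⧸ Ideal.span ({x} : Set R) where
  toFun f := ev x f
  map_add' _ _ := rfl
  map_smul' c f := by
    change (algebraMap k R c) • (ev x f) = _
    exact algebraMap_smul R c _

theorem ev_surj (x : R) : Function.Surjective (ev x) := fun m =>
  ⟨ModuleCat.ofHom (LinearMap.toSpanSingleton R _ m), by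
    change (1 : R) • m = m
    rw [one_smul]⟩

theorem ev_inj (x : R) : Function.Injective (ev x) := fun f g h => by
  apply ModuleCat.hom_ext
  exact LinearMap.ext_ring h

theorem mulHom_hom (x y : R) (f : ModuleCat.of R R ⟶ Mx x) :
    ev x (mulHom y ≫ f) = y • ev x f := by
  change f.hom (y * 1 : R) = y • (f.hom (1 : R))
  rw [← map_smul]; rfl

theorem mulHom_self (x : R) (f : ModuleCat.of R R ⟶ Mx x) :
    mulHom x ≫ f = 0 := by
  apply ev_inj
  rw [mulHom_hom]
  obtain ⟨r, hr⟩ := Ideal.Quotient.mk_surjective (ev x f)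
  rw [← hr]
  change Ideal.Quotient.mk _ (x * r) = 0
  rw [Ideal.Quotient.eq_zero_iff_mem, Ideal.mem_span_singleton]
  exact ⟨r, rfl⟩

theorem ext_equiv {x w : R} (h : x * w = 0) (h1 : ∀ r, w * r = 0 → x ∣ r)
    (h2 : ∀ r, x * r = 0 → w ∣ r) {T : Type}
    [AddCommGroup T] [Module k T] (ψ : R →ₗ[k] T) (hψ : Function.Surjective ψ)
    (hk : ∀ r, ψ r = 0 ↔ r ∈ Ideal.span ({x, w} : Set R)) (j : ℕ) (hj : 1 ≤ j) :
    Nonempty ((((Ext k (ModuleCat R) (2 * j)).obj (Opposite.op (Mx x))).obj (Mx x)) ≃ₗ[k] T) := by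
  obtain ⟨i, rfl⟩ : ∃ i, j = i + 1 := ⟨j - 1, by omega⟩
  let K := (cx h).linearYonedaObj k (Mx x)
  let e1 := (res h h1 h2).isoExt (R := k) (2 * (i + 1)) (Mx x)
  let e2 := K.homologyIsoSc' (2 * i + 1) (2 * (i + 1)) (2 * i + 3)
    (ComplexShape.prev_eq' _ (show 2 * i + 1 + 1 = 2 * (i + 1) by omega))
    (ComplexShape.next_eq' _ (show 2 * (i + 1) + 1 = 2 * i + 3 by omega))
  have hd1 : (cx h).d (2 * (i + 1)) (2 * i + 1) = mulHom w :=
    cx_d_even h _ _ (by omega) (by simp)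
  have hd2 : (cx h).d (2 * i + 3) (2 * (i + 1)) = mulHom x :=
    cx_d_odd h _ _ (by omega) (by simp [Nat.even_add_one, parity_simps])
  have hle : (Ideal.span ({x} : Set R)).restrictScalars k ≤ LinearMap.ker ψ := by
    intro r hr
    rw [LinearMap.mem_ker, hk]
    exact Ideal.span_mono (by simp) hr
  let ψ' : (R ⧸ Ideal.span ({x} : Set R)) →ₗ[k] T :=
    ((Ideal.span ({x} : Set R)).restrictScalars k).liftQ ψ hle
  have hψ' : ∀ r : R, ψ' (Ideal.Quotient.mk _ r) = ψ r := fun r => rfl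
  let L : (K.sc' (2 * i + 1) (2 * (i + 1)) (2 * i + 3)).X₂ →ₗ[k] T := ψ' ∘ₗ evL k x
  have hf : ∀ f : ModuleCat.of R R ⟶ Mx x,
      (K.sc' (2 * i + 1) (2 * (i + 1)) (2 * i + 3)).f.hom f = mulHom w ≫ f := by
    intro f
    change (cx h).d (2 * (i + 1)) (2 * i + 1) ≫ f = _
    rw [hd1]; rfl
  have hg : ∀ f : ModuleCat.of R R ⟶ Mx x,
      (K.sc' (2 * i + 1) (2 * (i + 1)) (2 * i + 3)).g.hom f = mulHom x ≫ f := by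
    intro f
    change (cx h).d (2 * i + 3) (2 * (i + 1)) ≫ f = _
    rw [hd2]; rfl
  obtain ⟨e3⟩ := homology_equiv (K.sc' (2 * i + 1) (2 * (i + 1)) (2 * i + 3)) (T := T) (by
      apply ModuleCat.hom_ext
      apply LinearMap.ext
      intro f
      refine (hg f).trans ?_
      exact mulHom_self x f) L (by
      intro t
      obtain ⟨r, rfl⟩ := hψ t
      obtain ⟨f, hf⟩ := ev_surj x (Ideal.Quotient.mk _ r)
      refine ⟨f, ?_⟩
      change ψ' (ev x f) = _
      rw [hf, hψ']) (by
      apply le_antisymm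
      · intro f hfL
        change ψ' (ev x f) = 0 at hfL
        obtain ⟨r, hr⟩ := Ideal.Quotient.mk_surjective (ev x f)
        rw [← hr, hψ', hk, Ideal.mem_span_pair] at hfL
        obtain ⟨a, b, hab⟩ := hfL
        obtain ⟨g, hg⟩ := ev_surj x (Ideal.Quotient.mk _ b)
        refine ⟨g, (hf g).trans ?_⟩
        apply ev_inj
        rw [mulHom_hom, hg]
        refine Eq.trans ?_ hr
        change Ideal.Quotient.mk _ (w * b) = _
        rw [Ideal.Quotient.eq, Ideal.mem_span_singleton]
        exact ⟨-a, by rw [← hab]; ring⟩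
      · rintro _ ⟨g, rfl⟩
        rw [LinearMap.mem_ker]
        refine (congrArg L (hf g)).trans ?_
        change ψ' (ev x (mulHom w ≫ g)) = 0
        obtain ⟨r, hr⟩ := Ideal.Quotient.mk_surjective (ev x g)
        refine (congrArg ψ' (mulHom_hom x w g)).trans ?_
        rw [← hr]
        change ψ (w * r) = 0
        rw [hk]
        exact Ideal.mul_mem_right _ _ (Ideal.subset_span (by simp)))
  exact ⟨(e1.toLinearEquiv.trans e2.toLinearEquiv).trans e3⟩

theorem hom_equiv (x : R) {A : Type} [CommRing A] [Algebra k A] (q : A →ₗ[k] R)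
    (hq : Function.Surjective q) {I : Ideal A}
    (hI : ∀ p, q p ∈ Ideal.span ({x} : Set R) ↔ p ∈ I) :
    Nonempty ((Mx x ⟶ Mx x) ≃ₗ[k] (A ⧸ I)) := by
  let π : R →ₗ[k] R ⧸ Ideal.span ({x} : Set R) :=
    (Submodule.mkQ (Ideal.span ({x} : Set R))).restrictScalars k
  let L : A →ₗ[k] R ⧸ Ideal.span ({x} : Set R) := π ∘ₗ q
  have hL : Function.Surjective L := (Submodule.mkQ_surjective _).comp hq
  have hk : LinearMap.ker L = I.restrictScalars k := by
    ext p
    rw [LinearMap.mem_ker, Submodule.restrictScalars_mem, ← hI]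
    exact Ideal.Quotient.eq_zero_iff_mem
  let e1 : (A ⧸ I.restrictScalars k) ≃ₗ[k] R ⧸ Ideal.span ({x} : Set R) :=
    (Submodule.quotEquivOfEq _ _ hk.symm).trans (L.quotKerEquivOfSurjective hL)
  let e0 : (A ⧸ I.restrictScalars k) ≃ₗ[k] (A ⧸ I) := Submodule.Quotient.restrictScalarsEquiv k I
  let E : (Mx x ⟶ Mx x) →ₗ[k] R ⧸ Ideal.span ({x} : Set R) :=
    { toFun := fun f => f.hom (Ideal.Quotient.mk _ 1)
      map_add' := fun _ _ => rfl
      map_smul' := fun c f => rfl }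
  have hE : Function.Bijective E := by
    constructor
    · intro f g h
      apply ModuleCat.hom_ext
      apply Submodule.linearMap_qext
      exact LinearMap.ext_ring h
    · intro m
      refine ⟨ModuleCat.ofHom (Submodule.liftQ _ (LinearMap.toSpanSingleton R _ m) ?_), ?_⟩
      · intro r hr
        obtain ⟨m, rfl⟩ := Ideal.Quotient.mk_surjective m
        change Ideal.Quotient.mk _ (r * m) = 0
        rw [Ideal.Quotient.eq_zero_iff_mem]
        exact Ideal.mul_mem_right _ _ hr
      · change (1 : R) • m = m
        rw [one_smul]
  exact ⟨(LinearEquiv.ofBijective E hE).trans (e1.symm.trans e0)⟩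

end ExtAux

/-- `Hom_B(O^a, O^a) ≅ A/(z_a)` and, for `j ≥ 1`,
`Ext^{2j}_B(O^a, O^a) ≅ A/(z_a, W^a)` as `k`-vector spaces. -/
theorem ext_even_hyperplane_self (k : Type) [Field k] (n : ℕ) (hn : 2 ≤ n) (a : Fin n) :
    Nonempty ((hyperplaneSheaf k n a ⟶ hyperplaneSheaf k n a) ≃ₗ[k]
      (MvPolynomial (Fin n) k ⧸
        Ideal.span ({X a} : Set (MvPolynomial (Fin n) k)))) ∧
    ∀ j : ℕ, 1 ≤ j →
      Nonempty
        ((((Ext k (ModuleCat (Bquot k n)) (2 * j)).obj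
            (Opposite.op (hyperplaneSheaf k n a))).obj (hyperplaneSheaf k n a)) ≃ₗ[k]
          (MvPolynomial (Fin n) k ⧸
            Ideal.span
              ({X a, ∏ b ∈ Finset.univ.erase a, X b} :
                Set (MvPolynomial (Fin n) k)))) := by
  classical
  set W : MvPolynomial (Fin n) k := ∏ b ∈ Finset.univ.erase a, X b with hW
  have hprod : (∏ b : Fin n, X b : MvPolynomial (Fin n) k) = X a * W :=
    (Finset.mul_prod_erase Finset.univ _ (Finset.mem_univ a)).symm
  have hX : (X a : MvPolynomial (Fin n) k) ≠ 0 := X_ne_zero a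
  have hW0 : W ≠ 0 := Finset.prod_ne_zero_iff.2 fun b _ => X_ne_zero b
  set I : Ideal (MvPolynomial (Fin n) k) := Ideal.span {∏ b : Fin n, X b} with hI
  have hmem : ∀ p, p ∈ I ↔ X a * W ∣ p := fun p => by
    rw [hI, Ideal.mem_span_singleton, hprod]
  constructor
  · have hJ : ∀ p : MvPolynomial (Fin n) k,
        Ideal.Quotient.mk I p ∈ Ideal.span ({Ideal.Quotient.mk I (X a)} : Set (Bquot k n)) ↔
          p ∈ Ideal.span ({X a} : Set (MvPolynomial (Fin n) k)) := by
      intro p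
      rw [Ideal.mem_span_singleton, Ideal.mem_span_singleton]
      constructor
      · rintro ⟨c, hc⟩
        obtain ⟨c, rfl⟩ := Ideal.Quotient.mk_surjective c
        rw [← map_mul, Ideal.Quotient.eq, hmem] at hc
        obtain ⟨d, hd⟩ := hc
        exact ⟨c + W * d, by linear_combination hd⟩
      · exact fun h => map_dvd _ h
    exact ExtAux.hom_equiv (k := k) (Ideal.Quotient.mk I (X a)) 
      ((Ideal.Quotient.mkₐ k I).toLinearMap) (Ideal.Quotient.mkₐ_surjective k I) hJ
  · intro j hj
    set J : Ideal (MvPolynomial (Fin n) k) := Ideal.span {X a, W} with hJ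
    have hIJ : I ≤ J := by
      intro p hp
      obtain ⟨d, rfl⟩ := (hmem p).1 hp
      rw [mul_assoc]
      exact Ideal.mul_mem_right _ _ (Ideal.subset_span (by simp))
    refine ExtAux.ext_equiv (k := k) (R := Bquot k n) (x := Ideal.Quotient.mk I (X a))
      (w := Ideal.Quotient.mk I W) ?_ ?_ ?_ (Ideal.Quotient.factorₐ k hIJ).toLinearMap
      (Ideal.Quotient.factor_surjective hIJ) ?_ j hj
    · rw [← map_mul, Ideal.Quotient.eq_zero_iff_mem, hmem]
    · intro r hr
      obtain ⟨r, rfl⟩ := Ideal.Quotient.mk_surjective r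
      rw [← map_mul, Ideal.Quotient.eq_zero_iff_mem, hmem, mul_comm (X a)] at hr
      exact map_dvd _ ((mul_dvd_mul_iff_left hW0).1 hr)
    · intro r hr
      obtain ⟨r, rfl⟩ := Ideal.Quotient.mk_surjective r
      rw [← map_mul, Ideal.Quotient.eq_zero_iff_mem, hmem] at hr
      exact map_dvd _ ((mul_dvd_mul_iff_left hX).1 hr)
    · intro r
      obtain ⟨r, rfl⟩ := Ideal.Quotient.mk_surjective r
      change Ideal.Quotient.mk J r = 0 ↔ _
      rw [Ideal.Quotient.eq_zero_iff_mem, hJ, Ideal.mem_span_pair, Ideal.mem_span_pair]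
      constructor
      · rintro ⟨c, d, rfl⟩
        exact ⟨Ideal.Quotient.mk I c, Ideal.Quotient.mk I d, by simp only [map_add, map_mul]; rfl⟩
      · rintro ⟨c, d, h⟩
        obtain ⟨c, rfl⟩ := Ideal.Quotient.mk_surjective c
        obtain ⟨d, rfl⟩ := Ideal.Quotient.mk_surjective d
        rw [← map_mul, ← map_mul, ← map_add, Ideal.Quotient.eq, hmem] at h
        obtain ⟨e, he⟩ := h
        exact ⟨c - W * e, d, by linear_combination he⟩

end
end

section
/- Let n ≥ 2 and a ∈ {1,…,n}. Then for every integer j ≥ 0, the odd Ext group Ext^{2j+1}_B(O^a, O^a) vanishes. (This is the vanishing of the odd-degree part of the paper's computation H^*(Hom(O^a, O^a)) ≅ A[u]/(z_a, u·W^a).) -/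
open CategoryTheory MvPolynomial

noncomputable section

set_option maxHeartbeats 1000000
set_option synthInstance.maxHeartbeats 1000000

/-- Multiplication by `x` as an endomorphism of `B` in `ModuleCat B`. -/
def mulEnd {B : Type} [CommRing B] (x : B) : ModuleCat.of B B ⟶ ModuleCat.of B B :=
  ModuleCat.ofHom (LinearMap.mulLeft B x)

lemma mulEnd_apply {B : Type} [CommRing B] (x b : B) : (mulEnd x).hom b = x * b := rfl

lemma mulEnd_comp {B : Type} [CommRing B] (x y : B) (h : x * y = 0) :
    mulEnd x ≫ mulEnd y = 0 := by
  ext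
  change y * (x * 1) = 0
  linear_combination h

/-- The two-periodic complex with differentials alternately `x` (odd to even) and `y`. -/
def periodicComplex {B : Type} [CommRing B] (x y : B) (h : x * y = 0) :
    ChainComplex (ModuleCat B) ℕ :=
  HomologicalComplex.alternatingConst (ModuleCat.of B B) (φ := mulEnd y) (ψ := mulEnd x)
    (mulEnd_comp y x (by rw [mul_comm, h])) (mulEnd_comp x y h)
    (fun _ _ => ComplexShape.down_nat_odd_add)

lemma periodicComplex_d_odd {B : Type} [CommRing B] (x y : B) (h : x * y = 0) (i : ℕ)
    (hi : Even i) : (periodicComplex x y h).d (i + 1) i = mulEnd x := by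
  have : ¬ Even (i + 1) := by rw [Nat.even_add_one]; simpa using hi
  change (if hij : (ComplexShape.down ℕ).Rel (i + 1) i then
      if hi : Even (i + 1) then mulEnd y else mulEnd x else 0) = _
  exact (dif_pos rfl).trans (dif_neg this)

lemma periodicComplex_d_even {B : Type} [CommRing B] (x y : B) (h : x * y = 0) (i : ℕ)
    (hi : ¬ Even i) : (periodicComplex x y h).d (i + 1) i = mulEnd y := by
  have : Even (i + 1) := by rw [Nat.even_add_one]; exact hi
  change (if hij : (ComplexShape.down ℕ).Rel (i + 1) i then
      if hi : Even (i + 1) then mulEnd y else mulEnd x else 0) = _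
  exact (dif_pos rfl).trans (dif_pos this)

/-- The augmentation. -/
def periodicπ {B : Type} [CommRing B] (x y : B) (h : x * y = 0) :
    periodicComplex x y h ⟶ (ChainComplex.single₀ (ModuleCat B)).obj
      (ModuleCat.of B (B ⧸ Ideal.span {x})) :=
  ((periodicComplex x y h).toSingle₀Equiv _).symm
    ⟨ModuleCat.ofHom (Submodule.mkQ (Ideal.span {x})), by
      rw [periodicComplex_d_odd x y h 0 (by simp)]
      refine ModuleCat.hom_ext (LinearMap.ext fun (b : B) => ?_)
      change Submodule.Quotient.mk (x * (b : B) : B) = _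
      exact (Submodule.Quotient.mk_eq_zero _).2
        (Ideal.mul_mem_right _ _ (Ideal.mem_span_singleton_self x))⟩

lemma periodicπ_f_zero {B : Type} [CommRing B] (x y : B) (h : x * y = 0) :
    (periodicπ x y h).f 0 = ModuleCat.ofHom (Submodule.mkQ (Ideal.span {x})) :=
  ChainComplex.toSingle₀Equiv_symm_apply_f_zero ..

lemma periodic_quasiIso {B : Type} [CommRing B] (x y : B) (h : x * y = 0)
    (hx : ∀ b, x * b = 0 → ∃ c, b = y * c) (hy : ∀ b, y * b = 0 → ∃ c, b = x * c) :
    QuasiIso (periodicπ x y h) where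
  quasiIsoAt m := by
    induction m with
    | zero =>
      rw [ChainComplex.quasiIsoAt₀_iff, ShortComplex.quasiIso_iff_of_zeros' _ rfl rfl rfl]
      constructor
      · rw [ShortComplex.moduleCat_exact_iff]
        intro b hb
        change ((periodicπ x y h).f 0).hom b = 0 at hb
        rw [periodicπ_f_zero] at hb
        obtain ⟨c, hc⟩ := Ideal.mem_span_singleton'.1 ((Submodule.Quotient.mk_eq_zero _).1 hb)
        refine ⟨c, ?_⟩
        change ((periodicComplex x y h).d 1 0).hom c = b
        rw [periodicComplex_d_odd x y h 0 (by simp)]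
        change x * c = b
        rw [mul_comm]; exact hc
      · change Epi ((periodicπ x y h).f 0)
        rw [periodicπ_f_zero]
        refine (ModuleCat.epi_iff_surjective
          (ModuleCat.ofHom (Submodule.mkQ (Ideal.span {x})))).2 ?_
        exact Submodule.mkQ_surjective _
    | succ m _ =>
      rw [quasiIsoAt_iff_exactAt' (hL := ChainComplex.exactAt_succ_single_obj ..),
          HomologicalComplex.exactAt_iff' _ (m + 2) (m + 1) m (by simp) (by simp),
          ShortComplex.moduleCat_exact_iff]
      intro b hb
      change ((periodicComplex x y h).d (m + 1) m).hom b = 0 at hb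
      change ∃ c, ((periodicComplex x y h).d (m + 1 + 1) (m + 1)).hom c = b
      by_cases hm : Even m
      · rw [periodicComplex_d_odd x y h m hm] at hb
        rw [periodicComplex_d_even x y h (m + 1) (by simpa [Nat.even_add_one] using hm)]
        obtain ⟨c, hc⟩ := hx b hb
        exact ⟨c, hc.symm⟩
      · rw [periodicComplex_d_even x y h m hm] at hb
        rw [periodicComplex_d_odd x y h (m + 1) (by rw [Nat.even_add_one]; exact hm)]
        obtain ⟨c, hc⟩ := hy b hb
        exact ⟨c, hc.symm⟩

/-- The periodic projective resolution of `B/(x)`. -/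
def periodicResolution {B : Type} [CommRing B] (x y : B) (h : x * y = 0)
    (hx : ∀ b, x * b = 0 → ∃ c, b = y * c) (hy : ∀ b, y * b = 0 → ∃ c, b = x * c) :
    ProjectiveResolution (ModuleCat.of B (B ⧸ Ideal.span {x})) where
  complex := periodicComplex x y h
  projective _ := inferInstanceAs (Projective (ModuleCat.of B B))
  π := periodicπ x y h
  quasiIso := periodic_quasiIso x y h hx hy

lemma ext_odd_zero (k : Type) [Field k] {B : Type} [CommRing B] [Algebra k B]
    (x y : B) (h : x * y = 0)
    (hx : ∀ b, x * b = 0 → ∃ c, b = y * c) (hy : ∀ b, y * b = 0 → ∃ c, b = x * c)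
    (M : ModuleCat B) (hM : ∀ m : M, y • m = 0 → m = 0) (j : ℕ) :
    Subsingleton (((Ext k (ModuleCat B) (2 * j + 1)).obj
      (Opposite.op (ModuleCat.of B (B ⧸ Ideal.span {x})))).obj M) := by
  rw [← ModuleCat.isZero_iff_subsingleton]
  refine Limits.IsZero.of_iso ?_ ((periodicResolution x y h hx hy).isoExt (2 * j + 1) M)
  rw [← HomologicalComplex.exactAt_iff_isZero_homology,
    HomologicalComplex.exactAt_iff' _ (2 * j) (2 * j + 1) (2 * j + 2) (by simp) (by simp),
    ShortComplex.moduleCat_exact_iff]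
  intro (f : ModuleCat.of B B ⟶ M) hf
  change (periodicComplex x y h).d (2 * j + 1 + 1) (2 * j + 1) ≫ f = 0 at hf
  rw [periodicComplex_d_even x y h (2 * j + 1) (by simp)] at hf
  have h1 : f.hom (y * 1) = 0 := congrArg (fun g => g.hom (1 : B)) hf
  have h0 : f = 0 := by
    refine ModuleCat.hom_ext (LinearMap.ext_ring ?_)
    apply hM
    have := f.hom.map_smul y (1 : B)
    rw [← this]; exact h1
  exact ⟨0, by rw [map_zero]; exact h0.symm⟩

lemma prod_split (k : Type) [Field k] (n : ℕ) (a : Fin n) :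
    (∏ b : Fin n, X b : MvPolynomial (Fin n) k) = X a * ∏ b ∈ Finset.univ.erase a, X b :=
  (Finset.mul_prod_erase _ _ (Finset.mem_univ a)).symm

lemma not_dvd_prod (k : Type) [Field k] (n : ℕ) (a : Fin n) :
    ¬ (X a : MvPolynomial (Fin n) k) ∣ ∏ b ∈ Finset.univ.erase a, X b := by
  intro hd
  obtain ⟨b, hb, h⟩ := (MvPolynomial.X_prime (R := k) (i := a)).exists_mem_finset_dvd hd
  rw [MvPolynomial.X_dvd_X] at h
  exact (Finset.ne_of_mem_erase hb) (by simpa using h.symm)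

/-- for every `j ≥ 0`, the odd Ext group
`Ext^{2j+1}_B(O^a, O^a)` vanishes. -/
theorem ext_odd_hyperplane_self_vanishes
    (k : Type) [Field k] (n : ℕ) (hn : 2 ≤ n) (a : Fin n) (j : ℕ) :
    Subsingleton
      (((Ext k (ModuleCat (Bquot k n)) (2 * j + 1)).obj
          (Opposite.op (hyperplaneSheaf k n a))).obj (hyperplaneSheaf k n a)) := by
  have hp : Prime (X a : MvPolynomial (Fin n) k) := MvPolynomial.X_prime
  have hs := prod_split k n a
  have hnd := not_dvd_prod k n a
  set w : MvPolynomial (Fin n) k := ∏ b ∈ Finset.univ.erase a, X b with hw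
  have hw0 : w ≠ 0 := fun e => hnd (e ▸ dvd_zero _)
  have key : ∀ p : MvPolynomial (Fin n) k,
      (Ideal.Quotient.mk (Ideal.span ({∏ b : Fin n, X b} : Set (MvPolynomial (Fin n) k))) p = 0
        ↔ X a * w ∣ p) := by
    intro p
    rw [Ideal.Quotient.eq_zero_iff_mem, Ideal.mem_span_singleton, hs]
  have hy : ∀ b : Bquot k n, Ideal.Quotient.mk _ w * b = 0 →
      ∃ c, b = Ideal.Quotient.mk _ (X a) * c := by
    intro b hb
    obtain ⟨p, rfl⟩ := Ideal.Quotient.mk_surjective b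
    rw [← map_mul, key, mul_comm (X a) w] at hb
    obtain ⟨c, rfl⟩ := (mul_dvd_mul_iff_left hw0).1 hb
    exact ⟨Ideal.Quotient.mk _ c, map_mul _ _ _⟩
  refine ext_odd_zero k (Ideal.Quotient.mk _ (X a)) (Ideal.Quotient.mk _ w) ?_ ?_ hy _ ?_ j
  · rw [← map_mul, key]
  · intro b hb
    obtain ⟨p, rfl⟩ := Ideal.Quotient.mk_surjective b
    rw [← map_mul, key] at hb
    obtain ⟨c, rfl⟩ := (mul_dvd_mul_iff_left hp.ne_zero).1 hb
    exact ⟨Ideal.Quotient.mk _ c, map_mul _ _ _⟩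
  · intro m hm
    obtain ⟨b, rfl⟩ := Submodule.Quotient.mk_surjective _ m
    obtain ⟨p, rfl⟩ := Ideal.Quotient.mk_surjective b
    rw [← Submodule.Quotient.mk_smul, Submodule.Quotient.mk_eq_zero, smul_eq_mul] at hm
    obtain ⟨c, hc⟩ := Ideal.mem_span_singleton'.1 hm
    obtain ⟨q, rfl⟩ := Ideal.Quotient.mk_surjective c
    rw [← map_mul, ← map_mul, ← sub_eq_zero, ← map_sub, key] at hc
    have h1 : X a ∣ w * p := by
      have h2 := (dvd_mul_right (X a) w).trans hc
      exact (dvd_sub_right (dvd_mul_left _ _)).1 h2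
    obtain ⟨c, rfl⟩ := (hp.dvd_or_dvd h1).resolve_left hnd
    rw [Submodule.Quotient.mk_eq_zero, map_mul]
    exact Ideal.mul_mem_right _ _ (Ideal.mem_span_singleton_self _)

end
end

section
/- Let n ≥ 2 and let a ≠ b be two indices in {1,…,n}. Then for every integer j ≥ 0, Ext^{2j+1}_B(O^a, O^b) is isomorphic to the quotient A/(z_a, z_b) as a k-vector space. (This is the paper's computation H^*(Hom(O^a, O^b)) ≅ A[u]/(z_a, z_b)[-1] for distinct coordinate hyperplanes, which is concentrated in odd degrees.) -/
open CategoryTheory MvPolynomial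

noncomputable section

set_option maxHeartbeats 1000000
set_option synthInstance.maxHeartbeats 1000000

section General

variable {B : Type} [CommRing B]

/-- multiplication by `x` on `B`, as a morphism of `ModuleCat B`. -/
def mulHom (x : B) : ModuleCat.of B B ⟶ ModuleCat.of B B :=
  ModuleCat.ofHom (LinearMap.mulLeft B x)

lemma mulHom_comp (x y : B) (h : x * y = 0) : mulHom x ≫ mulHom y = 0 := by
  ext
  simp [mulHom, mul_comm y x, h]

/-- the 2-periodic complex. -/
def perComplex (x y : B) (h : x * y = 0) : ChainComplex (ModuleCat B) ℕ :=
  HomologicalComplex.alternatingConst (ModuleCat.of B B) (φ := mulHom y) (ψ := mulHom x)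
    (mulHom_comp y x (by rw [mul_comm, h])) (mulHom_comp x y h)
    fun _ _ => ComplexShape.down_nat_odd_add

lemma perComplex_d_odd (x y : B) (h : x * y = 0) (i j : ℕ) (hij : j + 1 = i) (hi : Odd i) :
    (perComplex x y h).d i j = mulHom x := by
  subst hij
  simp [perComplex, HomologicalComplex.alternatingConst, if_neg (Nat.not_even_iff_odd.2 hi)]

lemma perComplex_d_even (x y : B) (h : x * y = 0) (i j : ℕ) (hij : j + 1 = i) (hi : Even i) :
    (perComplex x y h).d i j = mulHom y := by
  subst hij
  simp [perComplex, HomologicalComplex.alternatingConst, if_pos hi]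

def augHom (x : B) : ModuleCat.of B B ⟶ ModuleCat.of B (B ⧸ Ideal.span ({x} : Set B)) :=
  ModuleCat.ofHom (Submodule.mkQ (Ideal.span ({x} : Set B)))

def perπ (x y : B) (h : x * y = 0) :
    perComplex x y h ⟶
      (ChainComplex.single₀ (ModuleCat B)).obj
        (ModuleCat.of B (B ⧸ Ideal.span ({x} : Set B))) :=
  ((perComplex x y h).toSingle₀Equiv _).symm
    ⟨augHom x, by
      rw [perComplex_d_odd x y h 1 0 rfl odd_one]
      ext
      change Submodule.mkQ (Ideal.span ({x} : Set B)) (x * 1) = 0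
      rw [mul_one, Submodule.mkQ_apply, Submodule.Quotient.mk_eq_zero]
      exact Ideal.mem_span_singleton_self x⟩

lemma exact_mul (x y : B) (h : x * y = 0) (hy : ∀ t, y * t = 0 → x ∣ t) :
    (ShortComplex.mk (mulHom x) (mulHom y) (mulHom_comp x y h)).Exact := by
  rw [ShortComplex.moduleCat_exact_iff]
  intro t ht
  obtain ⟨s, rfl⟩ := hy t ht
  exact ⟨s, rfl⟩

lemma per_quasiIso (x y : B) (h : x * y = 0) (hx : ∀ t, x * t = 0 → y ∣ t)
    (hy : ∀ t, y * t = 0 → x ∣ t) : QuasiIso (perπ x y h) where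
  quasiIsoAt m := by
    induction m with
    | zero =>
      rw [ChainComplex.quasiIsoAt₀_iff, ShortComplex.quasiIso_iff_of_zeros' _ rfl rfl rfl]
      constructor
      · rw [ShortComplex.moduleCat_exact_iff]
        intro t ht
        have ht' : Submodule.mkQ (Ideal.span ({x} : Set B)) t = 0 := ht
        have ht2 : @Membership.mem B (Ideal B) _ (Ideal.span ({x} : Set B)) t :=
          (Submodule.Quotient.mk_eq_zero (Ideal.span ({x} : Set B))).1 ht'
        obtain ⟨s, hs⟩ := (Ideal.mem_span_singleton (α := B)).1 ht2
        refine ⟨s, ?_⟩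
        change ((perComplex x y h).d 1 0) s = _
        rw [perComplex_d_odd x y h 1 0 rfl odd_one]
        exact hs.symm
      · rw [ModuleCat.epi_iff_surjective]
        exact Submodule.mkQ_surjective (Ideal.span ({x} : Set B))
    | succ m _ =>
      rw [quasiIsoAt_iff_exactAt' (hL := ChainComplex.exactAt_succ_single_obj ..),
          HomologicalComplex.exactAt_iff' _ (m + 2) (m + 1) m (by simp) (by simp)]
      rw [ShortComplex.moduleCat_exact_iff]
      intro t ht
      change ((perComplex x y h).d (m + 1) m) t = 0 at ht
      change ∃ s, ((perComplex x y h).d (m + 2) (m + 1)) s = t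
      by_cases hm : Odd (m + 1)
      · rw [perComplex_d_odd x y h _ _ rfl hm] at ht
        rw [perComplex_d_even x y h _ _ rfl (by grind)]
        obtain ⟨s, hs⟩ := hx t ht
        exact ⟨s, hs.symm⟩
      · rw [perComplex_d_even x y h _ _ rfl (by grind)] at ht
        rw [perComplex_d_odd x y h _ _ rfl (by grind)]
        obtain ⟨s, hs⟩ := hy t ht
        exact ⟨s, hs.symm⟩

def perRes (x y : B) (h : x * y = 0) (hx : ∀ t, x * t = 0 → y ∣ t)
    (hy : ∀ t, y * t = 0 → x ∣ t) :
    ProjectiveResolution (ModuleCat.of B (B ⧸ Ideal.span ({x} : Set B))) where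
  complex := perComplex x y h
  projective _ := ModuleCat.projective_of_free (M := ModuleCat.of B B) (Module.Basis.singleton Unit B)
  π := perπ x y h
  quasiIso := per_quasiIso x y h hx hy

lemma homology_of_g_zero {k : Type} [Field k] (S : ShortComplex (ModuleCat.{0} k))
    {M : Type} [AddCommGroup M] [Module k M] (hg : ∀ t, S.g t = 0) (p : S.X₂ →ₗ[k] M)
    (hp : Function.Surjective p) (hk : ∀ t, p t = 0 ↔ ∃ s, S.f s = t) :
    Nonempty (S.homology ≃ₗ[k] M) := by
  let p' : LinearMap.ker S.g.hom →ₗ[k] M := p ∘ₗ (LinearMap.ker S.g.hom).subtype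
  have hp' : Function.Surjective p' := fun m => by
    obtain ⟨t, rfl⟩ := hp m
    exact ⟨⟨t, hg t⟩, rfl⟩
  have hker : LinearMap.range S.moduleCatToCycles = LinearMap.ker p' := by
    ext ⟨t, ht⟩
    constructor
    · rintro ⟨s, hs⟩
      exact (hk t).2 ⟨s, congrArg Subtype.val hs⟩
    · intro h
      obtain ⟨s, hs⟩ := (hk t).1 h
      exact ⟨s, Subtype.ext hs⟩
  exact ⟨S.moduleCatHomologyIso.toLinearEquiv ≪≫ₗ
    (Submodule.quotEquivOfEq _ _ hker) ≪≫ₗ p'.quotKerEquivOfSurjective hp'⟩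

theorem ext_general (k : Type) [Field k] [Algebra k B] (x y : B) (h : x * y = 0)
    (hx : ∀ t, x * t = 0 → y ∣ t)
    (hy : ∀ t, y * t = 0 → x ∣ t) (N : ModuleCat.{0} B) (hN : ∀ m : N, y • m = 0)
    {M : Type} [AddCommGroup M] [Module k M] (q : N →+ M)
    (hq : ∀ (r : k) (m : N), q (algebraMap k B r • m) = r • q m)
    (hs : Function.Surjective q) (hk : ∀ m, q m = 0 ↔ ∃ m', x • m' = m) (j : ℕ) :
    Nonempty ((((Ext k (ModuleCat B) (2 * j + 1)).obj
      (Opposite.op (ModuleCat.of B (B ⧸ Ideal.span ({x} : Set B))))).obj N) ≃ₗ[k] M) := by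
  let P := perRes x y h hx hy
  let K := P.complex.linearYonedaObj k N
  let e1 := (P.isoExt (R := k) (2 * j + 1) N).toLinearEquiv
  let e2 := (ShortComplex.homologyMapIso
    (K.isoSc' (2 * j) (2 * j + 1) (2 * j + 2) (by simp) (by simp))).toLinearEquiv
  let p : (ModuleCat.of B B ⟶ N) →ₗ[k] M :=
    { toFun := fun f => q (f.hom (1 : B))
      map_add' := fun f g => by
        rw [← map_add]; rfl
      map_smul' := fun r f => by
        rw [RingHom.id_apply, ← hq]; rfl }
  obtain ⟨e3⟩ := homology_of_g_zero (K.sc' (2 * j) (2 * j + 1) (2 * j + 2)) (M := M) (by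
      intro t
      change (perComplex x y h).d (2 * j + 2) (2 * j + 1) ≫ t = 0
      rw [perComplex_d_even x y h _ _ rfl (by grind)]
      change ModuleCat.of B B ⟶ N at t
      apply ModuleCat.hom_ext
      apply LinearMap.ext_ring
      change t.hom (y * (1 : B)) = 0
      rw [← smul_eq_mul, map_smul]
      exact hN _) p (by
      intro m
      obtain ⟨m, rfl⟩ := hs m
      refine ⟨ModuleCat.ofHom (LinearMap.toSpanSingleton B N m), ?_⟩
      change q ((1 : B) • m) = _
      rw [one_smul]) (by
      intro t
      change ModuleCat.of B B ⟶ N at t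
      change q (t.hom (1 : B)) = 0 ↔ ∃ s : ModuleCat.of B B ⟶ N, (perComplex x y h).d (2 * j + 1) (2 * j) ≫ s = t
      rw [perComplex_d_odd x y h _ _ rfl (by grind), hk]
      constructor
      · rintro ⟨m, hm⟩
        refine ⟨ModuleCat.ofHom (LinearMap.toSpanSingleton B N m), ?_⟩
        apply ModuleCat.hom_ext
        apply LinearMap.ext_ring
        refine Eq.trans ?_ hm
        change (x * (1 : B)) • m = x • m
        rw [mul_one]
      · rintro ⟨s, rfl⟩
        refine ⟨s.hom (1 : B), ?_⟩
        change _ = s.hom (x * (1 : B))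
        rw [← smul_eq_mul, map_smul])
  exact ⟨e1 ≪≫ₗ e2 ≪≫ₗ e3⟩

end General

section Concrete

theorem ext_concrete
    (k : Type) [Field k] (n : ℕ) (a b : Fin n) (hab : a ≠ b) (j : ℕ) :
    Nonempty
      ((((Ext k (ModuleCat (Bquot k n)) (2 * j + 1)).obj
          (Opposite.op (hyperplaneSheaf k n a))).obj (hyperplaneSheaf k n b)) ≃ₗ[k]
        (MvPolynomial (Fin n) k ⧸
          Ideal.span ({X a, X b} : Set (MvPolynomial (Fin n) k)))) := by
  let I : Ideal (MvPolynomial (Fin n) k) := Ideal.span {∏ b : Fin n, X b}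
  let Wa : MvPolynomial (Fin n) k := ∏ c ∈ Finset.univ.erase a, X c
  have hW : (∏ c : Fin n, X c : MvPolynomial (Fin n) k) = X a * Wa :=
    (Finset.mul_prod_erase _ _ (Finset.mem_univ a)).symm
  have hWa : Wa ≠ 0 := Finset.prod_ne_zero_iff.2 fun c _ => X_ne_zero c
  have hXa : (X a : MvPolynomial (Fin n) k) ≠ 0 := X_ne_zero a
  have hmem : ∀ T : MvPolynomial (Fin n) k, T ∈ I ↔ X a * Wa ∣ T := fun T => by
    rw [← hW]; exact Ideal.mem_span_singleton
  have hbW : (X b : MvPolynomial (Fin n) k) ∣ Wa :=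
    Finset.dvd_prod_of_mem _ (Finset.mem_erase.2 ⟨hab.symm, Finset.mem_univ b⟩)
  let J : Ideal (MvPolynomial (Fin n) k) := Ideal.span {X a, X b}
  have hIJ : ∀ T ∈ I, Ideal.Quotient.mk J T = 0 := fun T hT => by
    rw [Ideal.Quotient.eq_zero_iff_mem]
    obtain ⟨s, rfl⟩ := (hmem T).1 hT
    rw [mul_assoc]
    exact Ideal.mul_mem_right _ _ (Ideal.subset_span (by simp))
  let q₁ : Bquot k n →+* MvPolynomial (Fin n) k ⧸ J :=
    Ideal.Quotient.lift I (Ideal.Quotient.mk J) hIJ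
  let Lb : Ideal (Bquot k n) := Ideal.span {Ideal.Quotient.mk I (X b)}
  have hL : ∀ t ∈ Lb, q₁ t = 0 := fun t ht => by
    obtain ⟨s, rfl⟩ := Ideal.mem_span_singleton.1 ht
    rw [map_mul]
    have : q₁ (Ideal.Quotient.mk I (X b)) = 0 := by
      change Ideal.Quotient.mk J (X b) = 0
      rw [Ideal.Quotient.eq_zero_iff_mem]
      exact Ideal.subset_span (by simp)
    rw [this, zero_mul]
  let q : Bquot k n ⧸ Lb →+* MvPolynomial (Fin n) k ⧸ J := Ideal.Quotient.lift Lb q₁ hL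
  refine ext_general k (Ideal.Quotient.mk I (X a)) (Ideal.Quotient.mk I Wa) ?_ ?_ ?_
    (hyperplaneSheaf k n b) ?_ q.toAddMonoidHom ?_ ?_ ?_ j
  · rw [← map_mul, Ideal.Quotient.eq_zero_iff_mem, hmem]
  · intro t ht
    obtain ⟨T, rfl⟩ := Ideal.Quotient.mk_surjective t
    rw [← map_mul, Ideal.Quotient.eq_zero_iff_mem, hmem] at ht
    exact map_dvd _ ((mul_dvd_mul_iff_left hXa).1 ht)
  · intro t ht
    obtain ⟨T, rfl⟩ := Ideal.Quotient.mk_surjective t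
    rw [← map_mul, Ideal.Quotient.eq_zero_iff_mem, hmem, mul_comm] at ht
    exact map_dvd _ ((mul_dvd_mul_iff_left hWa).1 ht)
  · intro m
    obtain ⟨t, rfl⟩ := Ideal.Quotient.mk_surjective (I := Lb) m
    change Ideal.Quotient.mk Lb (Ideal.Quotient.mk I Wa * t) = 0
    rw [Ideal.Quotient.eq_zero_iff_mem]
    exact Ideal.mul_mem_right _ _ (Ideal.mem_span_singleton.2 (map_dvd _ hbW))
  · intro r m
    obtain ⟨t, rfl⟩ := Ideal.Quotient.mk_surjective (I := Lb) m
    obtain ⟨T, rfl⟩ := Ideal.Quotient.mk_surjective t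
    change Ideal.Quotient.mk J (C r * T) = r • Ideal.Quotient.mk J T
    rw [← smul_eq_C_mul]
    rfl
  · intro m
    obtain ⟨T, rfl⟩ := Ideal.Quotient.mk_surjective m
    exact ⟨Ideal.Quotient.mk Lb (Ideal.Quotient.mk I T), rfl⟩
  · intro m
    obtain ⟨t, rfl⟩ := Ideal.Quotient.mk_surjective (I := Lb) m
    obtain ⟨T, rfl⟩ := Ideal.Quotient.mk_surjective t
    change Ideal.Quotient.mk J T = 0 ↔ _
    rw [Ideal.Quotient.eq_zero_iff_mem]
    constructor
    · intro hT
      obtain ⟨u, v, rfl⟩ := Ideal.mem_span_pair.1 hT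
      refine ⟨Ideal.Quotient.mk Lb (Ideal.Quotient.mk I u), ?_⟩
      change Ideal.Quotient.mk Lb (Ideal.Quotient.mk I (X a) * Ideal.Quotient.mk I u) = _
      rw [Ideal.Quotient.eq, ← map_mul, ← map_sub]
      refine Ideal.mem_span_singleton.2 (map_dvd _ ⟨-v, by ring⟩)
    · rintro ⟨m', hm'⟩
      obtain ⟨t, rfl⟩ := Ideal.Quotient.mk_surjective (I := Lb) m'
      obtain ⟨U, rfl⟩ := Ideal.Quotient.mk_surjective t
      have h2 := congrArg q hm'
      change Ideal.Quotient.mk J (X a * U) = Ideal.Quotient.mk J T at h2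
      rw [← Ideal.Quotient.eq_zero_iff_mem, ← h2, Ideal.Quotient.eq_zero_iff_mem]
      exact Ideal.mul_mem_right _ _ (Ideal.subset_span (by simp))

end Concrete

/-- for `a ≠ b` and every `j ≥ 0`,
`Ext^{2j+1}_B(O^a, O^b) ≅ A/(z_a, z_b)` as `k`-vector spaces. -/
theorem ext_odd_hyperplane_distinct
    (k : Type) [Field k] (n : ℕ) (hn : 2 ≤ n) (a b : Fin n) (hab : a ≠ b) (j : ℕ) :
    Nonempty
      ((((Ext k (ModuleCat (Bquot k n)) (2 * j + 1)).obj
          (Opposite.op (hyperplaneSheaf k n a))).obj (hyperplaneSheaf k n b)) ≃ₗ[k]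
        (MvPolynomial (Fin n) k ⧸
          Ideal.span ({X a, X b} : Set (MvPolynomial (Fin n) k)))) := by
  exact ext_concrete k n a b hab j

end
end
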